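/- For all integers n ≥ 4 and k ≥ 2, every graph on n vertices with excess at least k has girth at most (2(n + k)/(3k))·(log₂ k + log₂ log₂ k + 4). -/

import Mathlib

open SimpleGraph

namespace GirthExcess

variable {V : Type}

/-- Two distinct non-backtracking walks with the same ends force a short cycle. -/
lemma walk_unique (G : SimpleGraph V) (L : ℕ)
    (hL : ∀ (v : V) (w : G.Walk v v), w.IsCycle → L < w.length)
    {u v : V} (p q : G.Walk u v) (hp : List.IsChain (· ≠ ·) p.edges)
    (hq : List.IsChain (· ≠ ·) q.edges) (hlen : p.length + q.length ≤ L) : p = q := by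
  classical
  set S : Finset (Sym2 V) := (p.edges ++ q.edges).toFinset with hS
  set H : SimpleGraph V := SimpleGraph.fromEdgeSet (S : Set (Sym2 V)) with hH
  have hSG : ∀ e ∈ S, e ∈ G.edgeSet := by
    intro e he
    simp only [hS, List.mem_toFinset, List.mem_append] at he
    rcases he with he | he
    · exact p.edges_subset_edgeSet he
    · exact q.edges_subset_edgeSet he
  have hHS : ∀ e ∈ H.edgeSet, e ∈ S := by
    intro e he
    rw [hH, SimpleGraph.edgeSet_fromEdgeSet] at he
    exact he.1
  have hSH : ∀ e ∈ S, e ∈ H.edgeSet := by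
    intro e he
    rw [hH, SimpleGraph.edgeSet_fromEdgeSet]
    exact ⟨he, G.not_isDiag_of_mem_edgeSet (hSG e he)⟩
  have hac : H.IsAcyclic := by
    intro x c hc
    have hcG : ∀ e ∈ c.edges, e ∈ G.edgeSet := fun e he =>
      hSG e (hHS e (c.edges_subset_edgeSet he))
    have h1 := hL x (c.transfer G hcG) (hc.transfer hcG)
    rw [Walk.length_transfer] at h1
    have h2 : c.edges.toFinset ⊆ S := by
      intro e he
      exact hHS e (c.edges_subset_edgeSet (List.mem_toFinset.1 he))
    have h3 := Finset.card_le_card h2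
    rw [List.toFinset_card_of_nodup hc.isTrail.edges_nodup, Walk.length_edges] at h3
    have h4 : S.card ≤ p.length + q.length := by
      have := List.toFinset_card_le (p.edges ++ q.edges)
      rw [hS]
      simpa only [List.length_append, Walk.length_edges] using this
    omega
  have hpH : ∀ e ∈ p.edges, e ∈ H.edgeSet := fun e he => hSH e (by simp [hS, he])
  have hqH : ∀ e ∈ q.edges, e ∈ H.edgeSet := fun e he => hSH e (by simp [hS, he])
  have hp' : (p.transfer H hpH).IsPath := by
    rw [hac.isPath_iff_isChain, Walk.edges_transfer]; exact hp
  have hq' : (q.transfer H hqH).IsPath := by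
    rw [hac.isPath_iff_isChain, Walk.edges_transfer]; exact hq
  have heq : p.transfer H hpH = q.transfer H hqH := by
    have := (hac.subsingleton_path u v).elim ⟨_, hp'⟩ ⟨_, hq'⟩
    exact congrArg Subtype.val this
  have h5 : (p.transfer H hpH).support = (q.transfer H hqH).support := by rw [heq]
  rw [Walk.support_transfer, Walk.support_transfer] at h5
  exact Walk.ext_support h5

/-- The non-backtracking successor relation on darts. -/
def NB (G : SimpleGraph V) (e f : G.Dart) : Prop := f.fst = e.snd ∧ f ≠ e.symm

lemma NB.edge_ne {G : SimpleGraph V} {e f : G.Dart} (h : NB G e f) : e.edge ≠ f.edge := by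
  intro h'
  rw [SimpleGraph.dart_edge_eq_iff] at h'
  rcases h' with h' | h'
  · subst h'
    exact G.loopless.irrefl _ (h.1 ▸ e.adj)
  · apply h.2
    rw [h', Dart.symm_symm]

lemma exists_walk (G : SimpleGraph V) (f : G.Dart) : ∀ (a : List G.Dart) (e : G.Dart),
    List.IsChain (NB G) (e :: (a ++ [f])) →
    ∃ p : G.Walk e.snd f.fst, p.darts = a ∧ List.IsChain (· ≠ ·) (e.edge :: p.edges) := by
  intro a
  induction a with
  | nil =>
    intro e h
    have h1 : NB G e f := by simpa using h
    exact ⟨Walk.nil.copy rfl h1.1.symm, by simp, by simp⟩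
  | cons x a ih =>
    intro e h
    rw [List.cons_append, List.isChain_cons_cons] at h
    obtain ⟨p, hp, hc⟩ := ih x h.2
    have hadj : G.Adj e.snd x.snd := h.1.1 ▸ x.adj
    refine ⟨Walk.cons hadj p, ?_, ?_⟩
    · rw [Walk.darts_cons, hp]
      congr 1
      ext
      · exact h.1.1.symm
      · rfl
    · rw [Walk.edges_cons]
      have hx : s(e.snd, x.snd) = x.edge := by
        rw [← h.1.1]; rfl
      rw [hx, List.isChain_cons_cons]
      exact ⟨h.1.edge_ne, hc⟩

lemma list_unique (G : SimpleGraph V) (L : ℕ)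
    (hL : ∀ (v : V) (w : G.Walk v v), w.IsCycle → L < w.length)
    (e f : G.Dart) (a b : List G.Dart)
    (ha : List.IsChain (NB G) (e :: (a ++ [f]))) (hb : List.IsChain (NB G) (e :: (b ++ [f])))
    (hlen : a.length + b.length ≤ L) : a = b := by
  obtain ⟨p, hp, hpc⟩ := exists_walk G f a e ha
  obtain ⟨q, hq, hqc⟩ := exists_walk G f b e hb
  have hl : p.length + q.length ≤ L := by
    rw [← Walk.length_darts, ← Walk.length_darts, hp, hq]; exact hlen
  have := walk_unique G L hL p q hpc.tail hqc.tail hl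
  rw [← hp, ← hq, this]

section Fin
variable [Fintype V]

open Classical in
/-- Successors of a dart. -/
noncomputable def succs (G : SimpleGraph V) (e : G.Dart) : Finset G.Dart :=
  Finset.univ.filter (NB G e)

open Classical in
/-- The degree of a vertex (number of darts leaving it). -/
noncomputable def br (G : SimpleGraph V) (v : V) : ℕ := G.degree v

open Classical in
lemma fiber (G : SimpleGraph V) (v : V) :
    (Finset.univ.filter (fun d : G.Dart => d.fst = v)).card = br G v := by
  rw [br]
  convert G.dart_fst_fiber_card_eq_degree v

lemma mem_succs {G : SimpleGraph V} {e f : G.Dart} : f ∈ succs G e ↔ NB G e f := by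
  simp [succs]

open Classical in
lemma card_succs (G : SimpleGraph V) (e : G.Dart) :
    (succs G e).card = br G e.snd - 1 := by
  have h : succs G e = (Finset.univ.filter (fun d : G.Dart => d.fst = e.snd)).erase e.symm := by
    ext f; simp [mem_succs, NB, and_comm]
  rw [h, Finset.card_erase_of_mem (by simp), fiber]

open Classical in
lemma card_preds (G : SimpleGraph V) (f : G.Dart) :
    (Finset.univ.filter (fun e => NB G e f)).card = br G f.fst - 1 := by
  have : Finset.univ.filter (fun e => NB G e f) = (succs G f.symm).image Dart.symm := by
    ext e
    simp only [Finset.mem_filter, Finset.mem_univ, true_and, Finset.mem_image, mem_succs]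
    constructor
    · rintro ⟨h1, h2⟩
      refine ⟨e.symm, ⟨h1.symm, ?_⟩, by simp⟩
      rw [Dart.symm_symm]; exact h2.symm
    · rintro ⟨x, ⟨h1, h2⟩, rfl⟩
      rw [Dart.symm_symm] at h2
      refine ⟨h1.symm, ?_⟩
      rw [Dart.symm_symm]; exact h2.symm
  rw [this, Finset.card_image_of_injective _ Dart.symm_involutive.injective, card_succs]
  rfl

open Classical in
/-- Lists of `t` darts continuing `e` without backtracking. -/
noncomputable def Lst (G : SimpleGraph V) : ℕ → G.Dart → Finset (List G.Dart)
  | 0, _ => {[]}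
  | t + 1, e => (succs G e).biUnion (fun f => (Lst G t f).image (List.cons f))

lemma card_Lst_succ (G : SimpleGraph V) (t : ℕ) (e : G.Dart) :
    (Lst G (t + 1) e).card = ∑ f ∈ succs G e, (Lst G t f).card := by
  classical
  rw [Lst, Finset.card_biUnion]
  · refine Finset.sum_congr rfl fun f _ => ?_
    rw [Finset.card_image_of_injective _ (List.cons_injective)]
  · intro x _ y _ hxy
    refine Finset.disjoint_left.2 ?_
    intro l hl hl'
    simp only [Finset.mem_image] at hl hl'
    obtain ⟨a, _, rfl⟩ := hl
    obtain ⟨b, _, h⟩ := hl'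
    simp at h
    exact hxy h.1.symm

lemma mem_Lst (G : SimpleGraph V) (t : ℕ) : ∀ (e : G.Dart) (l : List G.Dart), l ∈ Lst G t e →
    l.length = t ∧ List.IsChain (NB G) (e :: l) := by
  classical
  induction t with
  | zero => intro e l h; simp [Lst] at h; subst h; simp
  | succ t ih =>
    intro e l h
    simp only [Lst, Finset.mem_biUnion, Finset.mem_image] at h
    obtain ⟨f, hf, a, ha, rfl⟩ := h
    obtain ⟨h1, h2⟩ := ih f a ha
    refine ⟨by simp [h1], ?_⟩
    rw [List.isChain_cons_cons]
    exact ⟨mem_succs.1 hf, h2⟩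

lemma forced (G : SimpleGraph V) : ∀ (c d : List G.Dart) (f : G.Dart),
    List.IsChain (NB G) (f :: c) → List.IsChain (NB G) (f :: d) → c.length = d.length →
    (∀ x ∈ c, ¬ 3 ≤ br G x.fst) → c = d := by
  classical
  intro c
  induction c with
  | nil => intro d f _ _ h _; symm; simpa using h.symm
  | cons x c ih =>
    intro d f hc hd hl hx
    cases d with
    | nil => simp at hl
    | cons y d =>
      rw [List.isChain_cons_cons] at hc hd
      have hxy : x = y := by
        have h1 : (succs G f).card ≤ 1 := by
          rw [card_succs, ← hc.1.1]
          have := hx x (by simp)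
          omega
        exact Finset.card_le_one.1 h1 x (mem_succs.2 hc.1) y (mem_succs.2 hd.1)
      subst hxy
      rw [ih d x hc.2 hd.2 (by simpa using hl) (fun z hz => hx z (by simp [hz]))]

open Classical in
lemma card_Lst_le (G : SimpleGraph V) (t : ℕ)
    (hL : ∀ (v : V) (w : G.Walk v v), w.IsCycle → 2 * t < w.length) (e : G.Dart) :
    (Lst G (t + 1) e).card ≤ (Finset.univ.filter (fun f : G.Dart => 3 ≤ br G f.fst)).card + 1 := by
  rw [← Finset.card_insertNone]
  refine Finset.card_le_card_of_injOn
    (fun l => l.reverse.find? (fun f => decide (3 ≤ br G f.fst))) ?_ ?_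
  · intro l _
    simp only [Finset.mem_coe, Finset.mem_insertNone, Finset.mem_filter, Finset.mem_univ, true_and]
    intro f hf
    have := List.find?_some hf
    simpa using this
  · intro l hl m hm h
    obtain ⟨l1, l2⟩ := mem_Lst G _ e l (by simpa using hl)
    obtain ⟨m1, m2⟩ := mem_Lst G _ e m (by simpa using hm)
    simp only at h
    rcases hv : l.reverse.find? (fun f => decide (3 ≤ br G f.fst)) with _ | f
    · refine forced G l m e l2 m2 (by rw [l1, m1]) ?_
      rw [List.find?_eq_none] at hv
      intro x hx
      simpa using hv x (by simpa using hx)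
    · have hw := h ▸ hv
      rw [List.find?_eq_some_iff_append] at hv hw
      obtain ⟨_, a, b, hab, hal⟩ := hv
      obtain ⟨_, a', b', hab', hal'⟩ := hw
      have e1 : l = b.reverse ++ f :: a.reverse := by
        rw [← List.reverse_reverse l, hab]; simp
      have e2 : m = b'.reverse ++ f :: a'.reverse := by
        rw [← List.reverse_reverse m, hab']; simp
      rw [e1] at l1 l2
      rw [e2] at m1 m2
      have s1 : e :: (b.reverse ++ f :: a.reverse) = (e :: (b.reverse ++ [f])) ++ a.reverse := by simp
      have s2 : e :: (b'.reverse ++ f :: a'.reverse) = (e :: (b'.reverse ++ [f])) ++ a'.reverse := by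
        simp
      have hb : b.reverse = b'.reverse := by
        refine list_unique G (2 * t) hL e f _ _ (s1 ▸ l2).left_of_append
          (s2 ▸ m2).left_of_append ?_
        simp at l1 m1 ⊢
        omega
      have ha : a.reverse = a'.reverse := by
        have r1 : e :: (b.reverse ++ f :: a.reverse) = (e :: b.reverse) ++ (f :: a.reverse) := by simp
        have r2 : e :: (b'.reverse ++ f :: a'.reverse) = (e :: b'.reverse) ++ (f :: a'.reverse) := by
          simp
        refine forced G _ _ f (r1 ▸ l2).right_of_append (r2 ▸ m2).right_of_append ?_ ?_
        · have := congrArg List.length hb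
          simp at l1 m1 this ⊢
          omega
        · intro x hx
          simpa using hal x (by simpa using hx)
      rw [e1, e2, hb, ha]

lemma log_sum_ge {ι : Type*} (s : Finset ι) (x : ι → ℝ) (hs : 0 < s.card)
    (hx : ∀ i ∈ s, 0 < x i) :
    Real.log s.card + ∑ i ∈ s, (1 / (s.card : ℝ)) * Real.log (x i) ≤ Real.log (∑ i ∈ s, x i) := by
  have hc : (0 : ℝ) < s.card := by exact_mod_cast hs
  have h := strictConcaveOn_log_Ioi.concaveOn.le_map_sum (t := s)
    (w := fun _ => 1 / (s.card : ℝ)) (p := x) (fun i _ => by positivity)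
    (by simp; field_simp) (fun i hi => hx i hi)
  simp only [smul_eq_mul] at h
  rw [← Finset.mul_sum, ← Finset.mul_sum] at h
  have hpos : 0 < ∑ i ∈ s, x i := Finset.sum_pos hx (Finset.card_pos.1 hs)
  rw [Real.log_mul (by positivity) hpos.ne', one_div, Real.log_inv] at h
  rw [one_div, ← Finset.mul_sum]
  linarith

lemma card_Lst_pos (G : SimpleGraph V) (hd : ∀ e : G.Dart, 2 ≤ br G e.snd) (t : ℕ) :
    ∀ e, 0 < (Lst G t e).card := by
  induction t with
  | zero => intro e; simp [Lst]
  | succ t ih =>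
    intro e
    rw [card_Lst_succ]
    refine Finset.sum_pos (fun f _ => ih f) (Finset.card_pos.1 ?_)
    rw [card_succs]
    have := hd e
    omega

open Classical in
lemma entropy (G : SimpleGraph V) (hd : ∀ e : G.Dart, 2 ≤ br G e.snd) (t : ℕ) :
    (t : ℝ) * ∑ e : G.Dart, Real.log ((br G e.snd - 1 : ℕ) : ℝ) ≤
      ∑ e : G.Dart, Real.log (Lst G t e).card := by
  induction t with
  | zero => simp [Lst]
  | succ t ih =>
    have h1 : ∀ e : G.Dart, Real.log ((br G e.snd - 1 : ℕ) : ℝ) +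
        ∑ f ∈ succs G e, (1 / ((br G e.snd - 1 : ℕ) : ℝ)) * Real.log (Lst G t f).card ≤
        Real.log (Lst G (t + 1) e).card := by
      intro e
      have := log_sum_ge (succs G e) (fun f => ((Lst G t f).card : ℝ))
        (by rw [card_succs]; have := hd e; omega)
        (fun f _ => by exact_mod_cast card_Lst_pos G hd t f)
      rw [card_succs] at this
      rw [card_Lst_succ]
      push_cast
      exact_mod_cast this
    have h2 := Finset.sum_le_sum (fun e (_ : e ∈ Finset.univ) => h1 e)
    rw [Finset.sum_add_distrib] at h2
    have h3 : ∑ e : G.Dart, ∑ f ∈ succs G e,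
        (1 / ((br G e.snd - 1 : ℕ) : ℝ)) * Real.log (Lst G t f).card =
        ∑ f : G.Dart, Real.log (Lst G t f).card := by
      simp only [succs, Finset.sum_filter]
      rw [Finset.sum_comm]
      refine Finset.sum_congr rfl fun f _ => ?_
      rw [← Finset.sum_filter]
      have h4 : ∀ e ∈ Finset.univ.filter (fun e => NB G e f),
          (1 / ((br G e.snd - 1 : ℕ) : ℝ)) * Real.log (Lst G t f).card =
          (1 / ((br G f.fst - 1 : ℕ) : ℝ)) * Real.log (Lst G t f).card := by
        intro e he
        simp only [Finset.mem_filter, Finset.mem_univ, true_and] at he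
        rw [he.1]
      rw [Finset.sum_congr rfl h4, Finset.sum_const, card_preds, nsmul_eq_mul]
      have h5 : 2 ≤ br G f.fst := hd f.symm
      have h6 : ((br G f.fst - 1 : ℕ) : ℝ) ≠ 0 := by
        have : br G f.fst - 1 ≠ 0 := by omega
        exact_mod_cast this
      field_simp
    rw [h3] at h2
    push_cast
    linarith

lemma pow_ineq (d : ℕ) (hd : 2 ≤ d) : 8 ^ (d - 2) ≤ (d - 1) ^ d := by
  rcases Nat.lt_or_ge d 9 with h | h
  · interval_cases d <;> norm_num
  · calc 8 ^ (d - 2) ≤ 8 ^ d := Nat.pow_le_pow_right (by norm_num) (by omega)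
      _ ≤ (d - 1) ^ d := Nat.pow_le_pow_left (by omega) d

lemma log_ineq (d : ℕ) (hd : 2 ≤ d) :
    3 * ((d : ℝ) - 2) * Real.log 2 ≤ d * Real.log ((d - 1 : ℕ) : ℝ) := by
  have h : ((8 : ℝ) ^ (d - 2)) ≤ (((d - 1 : ℕ) : ℝ)) ^ d := by exact_mod_cast pow_ineq d hd
  have h2 := Real.log_le_log (by positivity) h
  rw [Real.log_pow, Real.log_pow, show (8 : ℝ) = 2 ^ 3 by norm_num, Real.log_pow,
    Nat.cast_sub hd] at h2
  push_cast at h2 ⊢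
  linarith

open Classical in
lemma sum_darts (G : SimpleGraph V) (g : V → ℝ) :
    ∑ e : G.Dart, g e.fst = ∑ v, (br G v : ℝ) * g v := by
  rw [← Finset.sum_fiberwise_of_maps_to (s := Finset.univ) (t := Finset.univ)
    (g := fun e : G.Dart => e.fst) (by simp)]
  refine Finset.sum_congr rfl fun v _ => ?_
  rw [Finset.sum_congr rfl (g := fun _ => g v) (by intro e he; simp at he; simp [he]),
    Finset.sum_const, fiber, nsmul_eq_mul]

open Classical in
lemma sum_darts' (G : SimpleGraph V) (g : V → ℝ) :
    ∑ e : G.Dart, g e.snd = ∑ v, (br G v : ℝ) * g v := by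
  rw [← sum_darts]
  exact Fintype.sum_bijective Dart.symm Dart.symm_involutive.bijective _ _ (fun e => rfl)

open Classical in
/-- The core bound, for graphs without vertices of degree one and of exact excess `k`. -/
lemma core (G : SimpleGraph V) (k : ℕ) (hk : 1 ≤ k) (m s : ℕ)
    (hm : G.edgeFinset.card = m) (hs : (Finset.univ.filter (fun v => 0 < br G v)).card = s)
    (hms : m = s + k) (hd : ∀ v, br G v ≠ 1) :
    ∃ (v : V) (w : G.Walk v v), w.IsCycle ∧
      (w.length : ℝ) ≤ 2 * (m : ℝ) / (3 * k) * Real.logb 2 (6 * k + 1) := by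
  by_contra! hcon
  set X : ℝ := 2 * (m : ℝ) / (3 * k) * Real.logb 2 (6 * k + 1) with hX
  have hk' : (1 : ℝ) ≤ k := by exact_mod_cast hk
  have hmpos : (0 : ℝ) < m := by
    have : 0 < m := by omega
    exact_mod_cast this
  have hlogpos : 0 ≤ Real.logb 2 (6 * k + 1) :=
    Real.logb_nonneg (by norm_num) (by linarith)
  have hX0 : 0 ≤ X := by positivity
  set t := ⌊X / 2⌋₊ with ht
  have ht1 : (t : ℝ) ≤ X / 2 := Nat.floor_le (by positivity)
  have ht2 : X / 2 < t + 1 := Nat.lt_floor_add_one _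
  have hL : ∀ (v : V) (w : G.Walk v v), w.IsCycle → 2 * t < w.length := by
    intro v w hw
    have := hcon v w hw
    have h2 : (2 * t : ℝ) < w.length := by linarith
    exact_mod_cast h2
  have hdd : ∀ e : G.Dart, 2 ≤ br G e.snd := by
    intro e
    have h1 : 0 < br G e.snd := by
      rw [br, SimpleGraph.degree_pos_iff_exists_adj]
      exact ⟨e.fst, e.adj.symm⟩
    have := hd e.snd
    omega
  -- sum of (d - 2) over the support
  set S := Finset.univ.filter (fun v => 0 < br G v) with hSdef
  have hdeg : ∑ v, br G v = 2 * m := by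
    rw [← hm]; exact G.sum_degrees_eq_twice_card_edges
  have hdegS : ∑ v ∈ S, br G v = 2 * m := by
    rw [← hdeg]
    refine Finset.sum_subset (Finset.subset_univ _) ?_
    intro v _ hv
    simpa [hSdef] using hv
  have hS2 : ∀ v ∈ S, 2 ≤ br G v := by
    intro v hv
    simp [hSdef] at hv
    have := hd v
    omega
  have hsum : ∑ v ∈ S, ((br G v : ℝ) - 2) = 2 * k := by
    rw [Finset.sum_sub_distrib, Finset.sum_const, hs, nsmul_eq_mul]
    have : (∑ v ∈ S, (br G v : ℝ)) = 2 * m := by exact_mod_cast hdegS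
    rw [this, hms]; push_cast; ring
  -- branch darts
  have hB : ((Finset.univ.filter (fun f : G.Dart => 3 ≤ br G f.fst)).card : ℝ) ≤ 6 * k := by
    rw [Finset.card_eq_sum_ones, Finset.sum_filter]
    push_cast
    rw [sum_darts G (fun v => if 3 ≤ br G v then (1 : ℝ) else 0)]
    have : ∑ v, (br G v : ℝ) * (if 3 ≤ br G v then (1 : ℝ) else 0) =
        ∑ v ∈ S, (br G v : ℝ) * (if 3 ≤ br G v then (1 : ℝ) else 0) := by
      symm
      refine Finset.sum_subset (Finset.subset_univ _) ?_
      intro v _ hv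
      have : br G v = 0 := by simpa [hSdef] using hv
      simp [this]
    rw [this]
    have h3 : ∀ v ∈ S, (br G v : ℝ) * (if 3 ≤ br G v then (1 : ℝ) else 0) ≤
        3 * ((br G v : ℝ) - 2) := by
      intro v hv
      have h2 := hS2 v hv
      split_ifs with h
      · have : (3 : ℝ) ≤ br G v := by exact_mod_cast h
        linarith
      · have : (2 : ℝ) ≤ br G v := by exact_mod_cast h2
        linarith
    refine (Finset.sum_le_sum h3).trans ?_
    rw [← Finset.mul_sum, hsum]
    linarith
  have hent := entropy G hdd (t + 1)
  rw [sum_darts' G (fun v => Real.log ((br G v - 1 : ℕ) : ℝ))] at hent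
  have hlow : 6 * k * Real.log 2 ≤ ∑ v, (br G v : ℝ) * Real.log ((br G v - 1 : ℕ) : ℝ) := by
    have : ∑ v, (br G v : ℝ) * Real.log ((br G v - 1 : ℕ) : ℝ) =
        ∑ v ∈ S, (br G v : ℝ) * Real.log ((br G v - 1 : ℕ) : ℝ) := by
      symm
      refine Finset.sum_subset (Finset.subset_univ _) ?_
      intro v _ hv
      have : br G v = 0 := by simpa [hSdef] using hv
      simp [this]
    rw [this]
    have h4 := Finset.sum_le_sum (fun v hv => log_ineq (br G v) (hS2 v hv))
    rw [← Finset.sum_mul, ← Finset.mul_sum, hsum] at h4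
    linarith
  have hup : ∑ e : G.Dart, Real.log (Lst G (t + 1) e).card ≤ 2 * m * Real.log (6 * k + 1) := by
    have h5 : ∀ e ∈ (Finset.univ : Finset G.Dart),
        Real.log (Lst G (t + 1) e).card ≤ Real.log (6 * k + 1) := by
      intro e _
      refine Real.log_le_log (by exact_mod_cast card_Lst_pos G hdd (t + 1) e) ?_
      have : ((Lst G (t + 1) e).card : ℝ) ≤
          (Finset.univ.filter (fun f : G.Dart => 3 ≤ br G f.fst)).card + 1 := by
        exact_mod_cast card_Lst_le G t hL e
      linarith
    refine (Finset.sum_le_sum h5).trans ?_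
    rw [Finset.sum_const, Finset.card_univ, dart_card_eq_twice_card_edges, hm, nsmul_eq_mul]
    push_cast
    rfl
  have hl2 : 0 < Real.log 2 := Real.log_pos (by norm_num)
  have h6 : ((t : ℝ) + 1) * (6 * k * Real.log 2) ≤ 2 * m * Real.log (6 * k + 1) := by
    push_cast at hent
    have := mul_le_mul_of_nonneg_left hlow (show (0 : ℝ) ≤ (t : ℝ) + 1 by positivity)
    linarith
  have h7 : X / 2 * (6 * k * Real.log 2) = 2 * m * Real.log (6 * k + 1) := by
    rw [hX, Real.logb]
    field_simp
    ring
  have h8 : X / 2 * (6 * k * Real.log 2) < ((t : ℝ) + 1) * (6 * k * Real.log 2) :=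
    mul_lt_mul_of_pos_right ht2 (by positivity)
  linarith

end Fin
/-- Reduction to an edge-minimal subgraph. -/
lemma exists_minimal [Fintype V] (k : ℕ) : ∀ (m : ℕ) (G : SimpleGraph V),
    G.edgeSet.ncard = m → G.support.ncard + k ≤ m →
    ∃ H ≤ G, H.edgeSet.ncard = H.support.ncard + k ∧ ∀ v, br H v ≠ 1 := by
  classical
  intro m
  induction m with
  | zero =>
    intro G hm hs
    refine ⟨G, le_rfl, by omega, ?_⟩
    intro v hv
    have hE : G.edgeSet = ∅ := (Set.ncard_eq_zero (Set.toFinite _)).1 hm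
    have hbot : G = ⊥ := by simpa using hE
    subst hbot
    simp [br] at hv
  | succ m ih =>
    intro G hm hs
    have key : ∀ e ∈ G.edgeSet, (G.deleteEdges {e}).edgeSet.ncard = m := by
      intro e he
      rw [SimpleGraph.edgeSet_deleteEdges, Set.ncard_sdiff_singleton_of_mem he, hm]
      rfl
    have hsup : ∀ e, (G.deleteEdges {e}).support ⊆ G.support := fun e =>
      SimpleGraph.support_mono (G.deleteEdges_le {e})
    by_cases h1 : ∃ v, br G v = 1
    · obtain ⟨v, hv⟩ := h1
      rw [br, SimpleGraph.degree_eq_one_iff_existsUnique_adj] at hv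
      obtain ⟨w, hw, hu⟩ := hv
      have he : s(v, w) ∈ G.edgeSet := hw
      have hv1 : v ∉ (G.deleteEdges {s(v, w)}).support := by
        rw [SimpleGraph.mem_support]
        rintro ⟨x, hx⟩
        rw [SimpleGraph.deleteEdges_adj] at hx
        have := hu x hx.1
        subst this
        exact hx.2 rfl
      have hv2 : v ∈ G.support := ⟨w, hw⟩
      have hlt : (G.deleteEdges {s(v, w)}).support.ncard < G.support.ncard :=
        Set.ncard_lt_ncard ⟨hsup _, fun h => hv1 (h hv2)⟩ (Set.toFinite _)
      obtain ⟨H, hH, h2⟩ := ih _ (key _ he) (by omega)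
      exact ⟨H, hH.trans (G.deleteEdges_le _), h2⟩
    · push Not at h1
      by_cases h3 : G.support.ncard + k = m + 1
      · exact ⟨G, le_rfl, by omega, h1⟩
      · have hne : G.edgeSet.Nonempty := by
          apply Set.nonempty_of_ncard_ne_zero; omega
        obtain ⟨e, he⟩ := hne
        have hle := Set.ncard_le_ncard (hsup e) (Set.toFinite _)
        obtain ⟨H, hH, h2⟩ := ih _ (key _ he) (by omega)
        exact ⟨H, hH.trans (G.deleteEdges_le _), h2⟩

lemma log_bound (k : ℕ) (hk : 2 ≤ k) :
    Real.logb 2 (6 * k + 1) ≤ Real.logb 2 k + Real.logb 2 (Real.logb 2 k) + 4 := by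
  have hk' : (2 : ℝ) ≤ k := by exact_mod_cast hk
  have h1 : (1 : ℝ) ≤ Real.logb 2 k := by
    rw [Real.le_logb_iff_rpow_le (by norm_num) (by linarith)]
    simpa using hk'
  have h2 : 0 ≤ Real.logb 2 (Real.logb 2 k) := Real.logb_nonneg (by norm_num) h1
  have h3 : Real.logb 2 (16 * k) = 4 + Real.logb 2 k := by
    rw [Real.logb_mul (by norm_num) (by linarith), show (16 : ℝ) = 2 ^ 4 by norm_num,
      Real.logb_pow]
    simp
  have h4 : Real.logb 2 (6 * k + 1) ≤ Real.logb 2 (16 * k) :=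
    Real.logb_le_logb_of_le (by norm_num) (by linarith) (by linarith)
  linarith

end GirthExcess

/-- **Theorem (Bollobás–Szemerédi).** For all `n ≥ 4` and `k ≥ 2`, every `n`-vertex graph
with excess at least `k` (i.e. with at least `n + k` edges) has girth at most
`(2(n + k)/(3k)) · (log₂ k + log₂ log₂ k + 4)`. -/
theorem girth_of_excess (n k : ℕ) (hn : 4 ≤ n) (hk : 2 ≤ k)
    (V : Type) [Fintype V] (G : SimpleGraph V) (hV : Fintype.card V = n)
    (hexcess : n + k ≤ G.edgeSet.ncard) :
    ∃ (v : V) (w : G.Walk v v), w.IsCycle ∧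
      (w.length : ℝ) ≤
        2 * ((n : ℝ) + k) / (3 * k) *
          (Real.logb 2 k + Real.logb 2 (Real.logb 2 k) + 4) := by
  classical
  have hle : ∀ H : SimpleGraph V, H.support.ncard ≤ n := by
    intro H
    rw [← hV, ← Nat.card_eq_fintype_card]
    exact Set.ncard_le_card _
  obtain ⟨H, hHG, hE, hd⟩ := GirthExcess.exists_minimal k _ G rfl
    (by have := hle G; omega)
  obtain ⟨v, w, hw, hlen⟩ := GirthExcess.core H k (by omega) _ H.support.ncard
    (by rw [← Set.ncard_coe_finset, SimpleGraph.coe_edgeFinset])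
    (by
      rw [← Set.ncard_coe_finset]
      congr 1
      ext v
      simp [GirthExcess.br, SimpleGraph.mem_support, SimpleGraph.degree_pos_iff_exists_adj])
    hE hd
  refine ⟨v, w.mapLe hHG, hw.mapLe hHG, ?_⟩
  rw [SimpleGraph.Walk.length_mapLe]
  refine hlen.trans ?_
  have hk' : (2 : ℝ) ≤ k := by exact_mod_cast hk
  have h1 : ((H.edgeSet.ncard : ℕ) : ℝ) ≤ n + k := by
    have := hle H
    have h2 : H.edgeSet.ncard ≤ n + k := by omega
    exact_mod_cast h2
  have h0 : 0 ≤ Real.logb 2 (6 * (k : ℝ) + 1) :=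
    Real.logb_nonneg (by norm_num) (by linarith)
  have h3 := GirthExcess.log_bound k hk
  gcongr
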